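/- Let n ≥ 1 and c ≥ 0 be integers. Then the sum Σ_Π q^{n(Π)} over all strict plane partitions Π with parts in {1,…,n} and at most c columns equals, in ℚ(q), the product ∏_{i=1}^{n} [c+i;q]_i/[i;q]_i (the Bender–Knuth formula). -/

import Mathlib

open Finset

noncomputable def q : RatFunc ℚ := RatFunc.X

noncomputable def qb (a : ℤ) : RatFunc ℚ := (1 - q ^ a) / (1 - q)

noncomputable def qfac (a : ℤ) (n : ℕ) : RatFunc ℚ := ∏ i ∈ Finset.range n, qb (a + i)

noncomputable def binq (n k : ℤ) : RatFunc ℚ :=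
  if 0 ≤ k ∧ k ≤ n then qfac (n - k + 1) k.toNat / qfac 1 k.toNat else 0

/-- A strict plane partition: entries `part i j` (row `i`, column `j`, both 0-indexed),
zero outside the shape; rows weakly decrease and columns strictly decrease on the shape. -/
structure SPP where
  part : ℕ → ℕ → ℕ
  supp_finite : {ij : ℕ × ℕ | part ij.1 ij.2 ≠ 0}.Finite
  row_decr : ∀ i j₁ j₂, j₁ ≤ j₂ → part i j₂ ≤ part i j₁
  col_strict : ∀ i j, part (i + 1) j ≠ 0 → part (i + 1) j < part i j

/-- The norm of a strict plane partition: the sum of its parts. -/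
noncomputable def sppNorm (P : SPP) : ℕ := ∑ᶠ ij : ℕ × ℕ, P.part ij.1 ij.2

/-- The length of the `i`-th row (0-indexed), i.e. the part `λ_{i+1}` of the shape. -/
noncomputable def rowLen (P : SPP) (i : ℕ) : ℕ := {j | P.part i j ≠ 0}.ncard

/-- The number of rows of odd length. -/
noncomputable def oddRows (P : SPP) : ℕ := {i | Odd (rowLen P i)}.ncard

/-- The number of parts equal to `n`. -/
noncomputable def eqCount (P : SPP) (n : ℕ) : ℕ := {ij : ℕ × ℕ | P.part ij.1 ij.2 = n}.ncard

section Pairs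

variable {R : Type*} [CommRing R]

/-- The product of `f (x i) (x j)` over all pairs `i < j`. -/
def pairProd (f : R → R → R) {n : ℕ} (x : Fin n → R) : R :=
  ∏ i, ∏ j ∈ Finset.Ioi i, f (x i) (x j)

theorem pairProd_succ (f : R → R → R) {n : ℕ} (x : Fin (n + 1) → R) :
    pairProd f x = (∏ j : Fin n, f (x 0) (x j.succ)) * pairProd f (fun j => x j.succ) := by
  simp only [pairProd, Fin.prod_univ_succ, Fin.prod_Ioi_zero, Fin.prod_Ioi_succ]

theorem pairProd_succAbove (f : R → R → R) (e : R) (hf : ∀ a b, f a b = e * f b a) {n : ℕ}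
    (x : Fin (n + 1) → R) (i : Fin (n + 1)) :
    pairProd f x = e ^ (i : ℕ) * pairProd f (fun j => x (i.succAbove j)) *
      ∏ j, f (x i) (x (i.succAbove j)) := by
  induction n with
  | zero =>
    have : i = 0 := by omega
    subst this
    simp [pairProd]
  | succ n ih =>
    induction i using Fin.cases with
    | zero => rw [pairProd_succ]; simp [mul_comm]
    | succ i =>
      rw [pairProd_succ, ih (fun j => x j.succ) i,
        pairProd_succ f (fun j => x (i.succ.succAbove j)),
        Fin.prod_univ_succAbove (fun j : Fin (n + 1) => f (x 0) (x j.succ)) i,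
        Fin.prod_univ_succ (fun j : Fin (n + 1) => f (x i.succ) (x (i.succ.succAbove j)))]
      simp only [Fin.succ_succAbove_zero, Fin.succ_succAbove_succ, Fin.val_succ, pow_succ]
      rw [hf (x 0) (x i.succ)]
      ring

end Pairs

/-- The rational function identity behind the summation of bounded alternants. -/
theorem sum_prod_one_sub_div {K : Type*} [Field K] [DecidableEq K] {ι : Type*} [DecidableEq ι]
    (s : Finset ι) (x : ι → K) (hx : Set.InjOn x s) (h1 : ∀ i ∈ s, x i ≠ -1) :
    ∑ i ∈ s, (1 - x i) * ∏ j ∈ s.erase i, (1 - x i * x j) / (x j - x i) = 1 - ∏ i ∈ s, x i := by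
  have hx' : Set.InjOn (fun o : Option ι => o.elim (-1) x) (Finset.insertNone s) := by
    rintro (_ | a) ha (_ | b) hb hab
    · rfl
    · exact absurd hab.symm (h1 b (by simpa using hb))
    · exact absurd hab (h1 a (by simpa using ha))
    · exact congrArg some (hx (by simpa using ha) (by simpa using hb) hab)
  set P : Polynomial K := ∏ j ∈ s, (1 - Polynomial.X * Polynomial.C (x j)) with hP
  have hdeg : P.natDegree ≤ #s := by
    refine (Polynomial.natDegree_prod_le _ _).trans ?_
    refine (Finset.sum_le_card_nsmul _ _ 1 fun j _ => ?_).trans (by simp)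
    compute_degree
  have hcoeff : P.coeff (#s) = ∏ j ∈ s, (-x j) := by
    have := Polynomial.coeff_prod_of_natDegree_le (s := s)
      (f := fun j => 1 - Polynomial.X * Polynomial.C (x j)) (n := 1)
      (fun j _ => by compute_degree)
    rw [mul_one] at this
    rw [hP, this]
    refine Finset.prod_congr rfl fun j _ => ?_
    simp [Polynomial.coeff_one]
  have key := Lagrange.coeff_eq_sum hx' (P := P) (by
    rw [Finset.card_insertNone]
    exact (Polynomial.degree_le_of_natDegree_le hdeg).trans_lt
      (by exact_mod_cast Nat.lt_succ_self _))
  rw [Finset.card_insertNone, Nat.add_sub_cancel, hcoeff] at key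
  have hnone : (Finset.insertNone s).erase none = s.map Function.Embedding.some := by
    ext (_ | a) <;> simp
  have hsome : ∀ i, (Finset.insertNone s).erase (some i) = Finset.insertNone (s.erase i) := by
    intro i
    ext (_ | a) <;> simp
  have heval : ∀ y, P.eval y = ∏ j ∈ s, (1 - y * x j) := by
    intro y
    rw [hP, Polynomial.eval_prod]
    refine Finset.prod_congr rfl fun j _ => ?_
    simp only [Polynomial.eval_sub, Polynomial.eval_one, Polynomial.eval_mul, Polynomial.eval_X,
      Polynomial.eval_C]
  rw [Finset.sum_insertNone, hnone] at key
  simp only [Option.elim_none, Option.elim_some, heval, Finset.prod_map,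
    Function.Embedding.some_apply, hsome, Finset.prod_insertNone] at key
  have h0 : (∏ j ∈ s, (1 - -1 * x j)) / ∏ j ∈ s, (-1 - x j) = (-1) ^ #s := by
    rw [← Finset.prod_div_distrib, ← Finset.prod_const]
    refine Finset.prod_congr rfl fun j hj => ?_
    have : -1 - x j ≠ 0 := fun h => h1 j hj (by linear_combination -h)
    field_simp
    ring
  have hterm : ∀ i ∈ s, (∏ j ∈ s, (1 - x i * x j)) / ((x i - -1) * ∏ j ∈ s.erase i, (x i - x j)) =
      -(-1) ^ #s * ((1 - x i) * ∏ j ∈ s.erase i, (1 - x i * x j) / (x j - x i)) := by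
    intro i hi
    have hc : (∏ j ∈ s.erase i, (x i - x j)) =
        -(-1) ^ #s * ∏ j ∈ s.erase i, (x j - x i) := by
      have : ∏ j ∈ s.erase i, (-1 : K) = -(-1) ^ #s := by
        rw [Finset.prod_const, ← Finset.card_erase_add_one hi, pow_succ]
        ring
      rw [← this, ← Finset.prod_mul_distrib]
      exact Finset.prod_congr rfl fun j _ => by ring
    have hi1 : x i - -1 ≠ 0 := fun h => h1 i hi (by linear_combination h)
    have hd : ∏ j ∈ s.erase i, (x j - x i) ≠ 0 := by
      refine Finset.prod_ne_zero_iff.2 fun j hj => sub_ne_zero.2 fun h => ?_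
      exact (Finset.mem_erase.1 hj).1 (hx (Finset.mem_of_mem_erase hj) hi h)
    rw [hc, ← Finset.mul_prod_erase s _ hi, Finset.prod_div_distrib]
    have h2 : ((-1 : K) ^ #s) * (-1) ^ #s = 1 := by rw [← mul_pow]; simp
    have h3 : ((-1 : K) ^ #s) ≠ 0 := by simp
    field_simp
    linear_combination (1 - x i) * (1 + x i) * (∏ j ∈ s.erase i, (1 - x i * x j)) * h2
  rw [h0, Finset.sum_congr rfl hterm, ← Finset.mul_sum] at key
  have h2 : ((-1 : K) ^ #s) * (-1) ^ #s = 1 := by rw [← mul_pow]; simp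
  have h4 : ∏ j ∈ s, (-x j) = (-1) ^ #s * ∏ j ∈ s, x j := by
    rw [← Finset.prod_const, ← Finset.prod_mul_distrib]
    simp
  rw [h4] at key
  linear_combination ((-1) ^ #s) * key +
    (1 - ∏ j ∈ s, x j - ∑ i ∈ s, (1 - x i) * ∏ j ∈ s.erase i, (1 - x i * x j) / (x j - x i)) * h2

section Alternants

variable {K : Type*} [Field K]

/-- The odd orthogonal alternant of a rectangle. -/
def rectAlternant (M : ℕ) {n : ℕ} (x : Fin n → K) : K :=
  Matrix.det (Matrix.of fun i j : Fin n => x i ^ (j.rev : ℕ) - x i ^ (M + j))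

/-- Invert the variables selected by `ε`. -/
def flipVars {n : ℕ} (x : Fin n → K) (ε : Fin n → Bool) (i : Fin n) : K :=
  if ε i then (x i)⁻¹ else x i

/-- The weight with which a choice of inverted variables enters `rectAlternant`. -/
def flipWeight (M : ℕ) {n : ℕ} (x : Fin n → K) (ε : Fin n → Bool) : K :=
  ∏ i, if ε i then -(x i ^ (M + n) * (x i)⁻¹) else 1

theorem rectAlternant_eq_sum (M : ℕ) {n : ℕ} (x : Fin n → K) (hx : ∀ i, x i ≠ 0) :
    rectAlternant M x = ∑ ε : Fin n → Bool,
      flipWeight M x ε * pairProd (fun a b => a - b) (flipVars x ε) := by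
  have h := MultilinearMap.map_sum (α := fun _ : Fin n => Bool)
    (Matrix.detRowAlternating (n := Fin n) (R := K)).toMultilinearMap
    (fun i b j => if b then -x i ^ (M + j) else x i ^ (j.rev : ℕ))
  have h1 : rectAlternant M x = (Matrix.detRowAlternating (n := Fin n) (R := K)).toMultilinearMap
      (fun i => ∑ b : Bool, fun j : Fin n => if b then -x i ^ (M + j) else x i ^ (j.rev : ℕ)) := by
    refine congrArg Matrix.det ?_
    ext i j
    simp
    ring
  rw [h1, h]
  refine Finset.sum_congr rfl fun ε _ => ?_
  have h2 : pairProd (fun a b => a - b) (flipVars x ε) =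
      (Matrix.projVandermonde 1 (flipVars x ε)).det := by
    simp [Matrix.det_projVandermonde, pairProd]
  rw [h2, flipWeight, ← Matrix.det_mul_column]
  refine congrArg Matrix.det ?_
  ext i j
  have hj : M + n = M + j + ((j.rev : ℕ) + 1) := by rw [Fin.val_rev]; omega
  cases hε : ε i
  · simp [Matrix.projVandermonde_apply, flipVars, hε]
  · simp only [Matrix.projVandermonde_apply, flipVars, hε, if_true, hj, pow_add, Matrix.of_apply]
    have := hx i
    simp
    field_simp

theorem flipWeight_succ (M : ℕ) {n : ℕ} (x : Fin n → K) (ε : Fin n → Bool) :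
    flipWeight (M + 1) x ε = flipWeight M x ε * ∏ i with ε i = true, x i := by
  rw [flipWeight, flipWeight, Finset.prod_filter, ← Finset.prod_mul_distrib]
  refine Finset.prod_congr rfl fun i _ => ?_
  split_ifs <;> ring

theorem sum_comp_succAbove {n : ℕ} (i : Fin (n + 1)) (f : (Fin n → Bool) → K) :
    ∑ ε : Fin n → Bool, f ε =
      ∑ ε : Fin (n + 1) → Bool, if ε i = true then f (fun j => ε (i.succAbove j)) else 0 := by
  rw [← (Fin.insertNthEquiv (fun _ => Bool) i).sum_comp, Fintype.sum_prod_type]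
  simp [Fin.insertNthEquiv]

/-- The contribution of one inverted variable to the recursion. -/
theorem flip_term (M : ℕ) {n : ℕ} (x : Fin (n + 1) → K) (hx : ∀ i, x i ≠ 0)
    (hinj : Function.Injective x) (ε : Fin (n + 1) → Bool) (i : Fin (n + 1)) (hi : ε i = true) :
    (-1) ^ (i : ℕ) * x i ^ M * (1 - x i) * (∏ j, (1 - x i * x (i.succAbove j))) *
      (flipWeight M (fun j => x (i.succAbove j)) (fun j => ε (i.succAbove j)) *
        pairProd (fun a b => a - b) (flipVars (fun j => x (i.succAbove j))
          (fun j => ε (i.succAbove j)))) =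
    -(flipWeight M x ε * pairProd (fun a b => a - b) (flipVars x ε)) *
      ((1 - x i) * ∏ j with ε (i.succAbove j) = true,
        (1 - x i * x (i.succAbove j)) / (x (i.succAbove j) - x i)) := by
  rw [pairProd_succAbove (fun a b => a - b) (-1) (fun a b => by ring) (flipVars x ε) i]
  have h1 : flipVars (fun j => x (i.succAbove j)) (fun j => ε (i.succAbove j)) =
    fun j => flipVars x ε (i.succAbove j) := rfl
  rw [h1]
  set V := pairProd (fun a b => a - b) fun j => flipVars x ε (i.succAbove j)
  have h2 : flipWeight M x ε = -(x i ^ (M + (n + 1)) * (x i)⁻¹) *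
      ∏ j, if ε (i.succAbove j) then
        -(x (i.succAbove j) ^ (M + (n + 1)) * (x (i.succAbove j))⁻¹) else 1 := by
    rw [flipWeight, Fin.prod_univ_succAbove _ i]
    simp [hi]
  have h3 : (∏ j, (1 - x i * x (i.succAbove j))) *
      flipWeight M (fun j => x (i.succAbove j)) (fun j => ε (i.succAbove j)) =
      x i ^ n * (∏ j, if ε (i.succAbove j) then
        -(x (i.succAbove j) ^ (M + (n + 1)) * (x (i.succAbove j))⁻¹) else 1) *
      (∏ j, (flipVars x ε i - flipVars x ε (i.succAbove j))) *
      ∏ j with ε (i.succAbove j) = true,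
        (1 - x i * x (i.succAbove j)) / (x (i.succAbove j) - x i) := by
    have : x i ^ n = ∏ _j : Fin n, x i := by simp
    rw [this, flipWeight, Finset.prod_filter, ← Finset.prod_mul_distrib, ← Finset.prod_mul_distrib,
      ← Finset.prod_mul_distrib, ← Finset.prod_mul_distrib]
    refine Finset.prod_congr rfl fun j _ => ?_
    have e1 := hx i
    have e2 := hx (i.succAbove j)
    have e3 : x (i.succAbove j) - x i ≠ 0 :=
      sub_ne_zero.2 fun h => Fin.succAbove_ne i j (hinj h)
    cases hε : ε (i.succAbove j)
    · simp [flipVars, hi, hε]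
      field_simp
    · simp [flipVars, hi, hε]
      field_simp
      ring
  have e1 := hx i
  have h4 : x i ^ (M + (n + 1)) * (x i)⁻¹ = x i ^ M * x i ^ n := by
    field_simp
    ring
  rw [h2, h4]
  linear_combination ((-1) ^ (i : ℕ) * x i ^ M * (1 - x i) * V) * h3

theorem rectAlternant_succ_sub (M : ℕ) {n : ℕ} (x : Fin (n + 1) → K) (hx : ∀ i, x i ≠ 0)
    (hinj : Function.Injective x) (h1 : ∀ i, x i ≠ -1) :
    rectAlternant (M + 1) x = rectAlternant M x +
      ∑ i : Fin (n + 1), (-1) ^ (i : ℕ) * x i ^ M * (1 - x i) *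
        (∏ j, (1 - x i * x (i.succAbove j))) * rectAlternant M (fun j => x (i.succAbove j)) := by
  classical
  have hR : ∀ i, rectAlternant M (fun j => x (i.succAbove j)) =
      ∑ ε : Fin (n + 1) → Bool, if ε i = true then
        flipWeight M (fun j => x (i.succAbove j)) (fun j => ε (i.succAbove j)) *
        pairProd (fun a b => a - b) (flipVars (fun j => x (i.succAbove j))
          (fun j => ε (i.succAbove j))) else 0 := by
    intro i
    rw [rectAlternant_eq_sum M _ (fun j => hx _), sum_comp_succAbove i]
  simp only [hR, Finset.mul_sum]
  rw [Finset.sum_comm, rectAlternant_eq_sum _ x hx, rectAlternant_eq_sum _ x hx,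
    ← Finset.sum_add_distrib]
  refine Finset.sum_congr rfl fun ε _ => ?_
  have hi : ∀ i : Fin (n + 1), (-1) ^ (i : ℕ) * x i ^ M * (1 - x i) *
      (∏ j, (1 - x i * x (i.succAbove j))) *
      (if ε i = true then flipWeight M (fun j => x (i.succAbove j)) (fun j => ε (i.succAbove j)) *
        pairProd (fun a b => a - b) (flipVars (fun j => x (i.succAbove j))
          (fun j => ε (i.succAbove j))) else 0) =
      if ε i = true then -(flipWeight M x ε * pairProd (fun a b => a - b) (flipVars x ε)) *
        ((1 - x i) * ∏ j ∈ (Finset.univ.filter fun j => ε j = true).erase i,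
          (1 - x i * x j) / (x j - x i)) else 0 := by
    intro i
    split_ifs with hε
    · rw [flip_term M x hx hinj ε i hε]
      congr 2
      have : (Finset.univ.filter fun j => ε j = true).erase i =
          (Finset.univ.filter fun j => ε (i.succAbove j) = true).map i.succAboveEmb := by
        ext j
        rcases Fin.eq_self_or_eq_succAbove i j with rfl | ⟨k, rfl⟩
        · simp [Fin.succAbove_ne]
        · simp [Fin.succAbove_ne]
      rw [this, Finset.prod_map]
      rfl
    · simp
  rw [Finset.sum_congr rfl fun i _ => hi i, ← Finset.sum_filter, ← Finset.mul_sum,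
    sum_prod_one_sub_div _ x hinj.injOn fun i _ => h1 i, flipWeight_succ]
  ring

end Alternants

/-- The strictly decreasing sequences of `n` natural numbers below `M`. -/
def strictSeqs (n M : ℕ) : Finset (Fin n → ℕ) :=
  {l ∈ Fintype.piFinset fun _ => Finset.range M | StrictAnti l}

theorem mem_strictSeqs {n M : ℕ} {l : Fin n → ℕ} :
    l ∈ strictSeqs n M ↔ (∀ i, l i < M) ∧ StrictAnti l := by
  simp [strictSeqs]

theorem strictAnti_cons {n a : ℕ} {l : Fin n → ℕ} (h : ∀ i, l i < a) (hl : StrictAnti l) :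
    StrictAnti (Fin.cons a l : Fin (n + 1) → ℕ) := by
  intro i j hij
  induction j using Fin.cases with
  | zero => simp at hij
  | succ j =>
    induction i using Fin.cases with
    | zero => simpa using h j
    | succ i => simpa using hl (Fin.succ_lt_succ_iff.1 hij)

theorem sum_strictSeqs_succ {K : Type*} [AddCommMonoid K] (n M : ℕ) (f : (Fin (n + 1) → ℕ) → K) :
    ∑ l ∈ strictSeqs (n + 1) (M + 1), f l =
      ∑ l ∈ strictSeqs (n + 1) M, f l + ∑ l ∈ strictSeqs n M, f (Fin.cons M l) := by
  have hu : strictSeqs (n + 1) (M + 1) = strictSeqs (n + 1) M ∪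
      (strictSeqs n M).image fun l => (Fin.cons M l : Fin (n + 1) → ℕ) := by
    ext l
    simp only [Finset.mem_union, Finset.mem_image, mem_strictSeqs]
    constructor
    · rintro ⟨h, hl⟩
      by_cases h0 : l 0 < M
      · exact Or.inl ⟨fun i => (hl.antitone (Fin.zero_le i)).trans_lt h0, hl⟩
      · have h0' : l 0 = M := by have := h 0; omega
        refine Or.inr ⟨Fin.tail l, ⟨fun i => ?_, fun i j hij => hl (Fin.succ_lt_succ_iff.2 hij)⟩, ?_⟩
        · rw [← h0']
          exact hl (Fin.succ_pos i)
        · rw [← h0', Fin.cons_self_tail]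
    · rintro (⟨h, hl⟩ | ⟨l, ⟨h, hl⟩, rfl⟩)
      · exact ⟨fun i => (h i).trans M.lt_succ_self, hl⟩
      · refine ⟨fun i => ?_, strictAnti_cons h hl⟩
        induction i using Fin.cases with
        | zero => simp
        | succ i => simpa using (h i).trans M.lt_succ_self
  rw [hu, Finset.sum_union, Finset.sum_image]
  · exact fun a _ b _ hab => Fin.cons_right_injective (α := fun _ => ℕ) M hab
  · rw [Finset.disjoint_left]
    intro l hl hl'
    obtain ⟨l', -, rfl⟩ := Finset.mem_image.1 hl'
    simpa using (mem_strictSeqs.1 hl).1 0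

section BoundedSum

variable {K : Type*} [Field K]

/-- The sum of the alternants `det (x i ^ l j)` over strictly decreasing `l` bounded by `M`. -/
def alternantSum (M : ℕ) {n : ℕ} (x : Fin n → K) : K :=
  ∑ l ∈ strictSeqs n M, Matrix.det (Matrix.of fun i j => x i ^ l j)

theorem alternantSum_succ (M : ℕ) {n : ℕ} (x : Fin (n + 1) → K) :
    alternantSum (M + 1) x = alternantSum M x +
      ∑ i : Fin (n + 1), (-1) ^ (i : ℕ) * x i ^ M * alternantSum M fun j => x (i.succAbove j) := by
  simp only [alternantSum, Finset.mul_sum]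
  rw [sum_strictSeqs_succ, Finset.sum_comm]
  congr 1
  refine Finset.sum_congr rfl fun l _ => ?_
  rw [Matrix.det_succ_column_zero]
  rfl

theorem rectAlternant_zero {n : ℕ} (x : Fin (n + 1) → K) : rectAlternant 0 x = 0 := by
  refine Matrix.exists_mulVec_eq_zero_iff.1 ⟨1, one_ne_zero, ?_⟩
  ext i
  simp only [Matrix.mulVec, dotProduct, Matrix.of_apply, Pi.one_apply, mul_one, zero_add,
    Finset.sum_sub_distrib, Pi.zero_apply]
  rw [sub_eq_zero]
  exact Equiv.sum_comp Fin.revPerm fun j : Fin (n + 1) => x i ^ (j : ℕ)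

theorem alternantSum_mul (M : ℕ) {n : ℕ} (x : Fin n → K) (hx : ∀ i, x i ≠ 0)
    (hinj : Function.Injective x) (h1 : ∀ i, x i ≠ -1) :
    alternantSum M x * ((∏ i, (1 - x i)) * pairProd (fun a b => 1 - a * b) x) =
      rectAlternant M x := by
  induction M generalizing n with
  | zero =>
    cases n with
    | zero => simp [alternantSum, rectAlternant, pairProd, strictSeqs, Subsingleton.strictAnti]
    | succ n =>
      have : strictSeqs (n + 1) 0 = ∅ := by
        ext l
        simp [mem_strictSeqs]
      rw [rectAlternant_zero, alternantSum, this]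
      simp
  | succ M ih =>
    cases n with
    | zero => simp [alternantSum, rectAlternant, pairProd, strictSeqs, Subsingleton.strictAnti]
    | succ n =>
      rw [alternantSum_succ, rectAlternant_succ_sub M x hx hinj h1, ← ih x hx hinj h1, add_mul,
        Finset.sum_mul]
      congr 1
      refine Finset.sum_congr rfl fun i _ => ?_
      rw [← ih _ (fun j => hx _) (hinj.comp Fin.succAbove_right_injective) (fun j => h1 _),
        pairProd_succAbove (fun a b => 1 - a * b) 1 (fun a b => by ring) x i,
        Fin.prod_univ_succAbove (fun i => 1 - x i) i]
      ring

end BoundedSum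

theorem prod_prod_Ioi_eq {K : Type*} [CommMonoid K] (n : ℕ) (g : ℕ → ℕ → K) :
    ∏ i : Fin n, ∏ j ∈ Finset.Ioi i, g i j =
      ∏ j ∈ Finset.range n, ∏ i ∈ Finset.range j, g i j := by
  have h : ∀ i : Fin n, ∏ j ∈ Finset.Ioi i, g i j =
      ∏ j ∈ Finset.range n, if (i : ℕ) < j then g i j else 1 := by
    intro i
    rw [Finset.prod_range (fun j => if (i : ℕ) < j then g i j else 1)]
    simp only [← Fin.lt_def]
    rw [← Finset.prod_filter]
    congr 1
    ext
    simp
  rw [Finset.prod_congr rfl fun i _ => h i,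
    ← Finset.prod_range (fun i => ∏ j ∈ Finset.range n, if i < j then g i j else 1),
    Finset.prod_comm]
  refine Finset.prod_congr rfl fun j hj => ?_
  rw [← Finset.prod_filter]
  congr 1
  ext i
  have := Finset.mem_range.1 hj
  simp only [Finset.mem_filter, Finset.mem_range]
  omega

section PrincipalSpecialization

variable {K : Type*} [Field K]

open Polynomial in
/-- Two-variable Chebyshev polynomials of the second kind. -/
noncomputable def chebU (κ : K) : ℕ → K[X]
  | 0 => 1
  | 1 => X
  | k + 2 => X * chebU κ (k + 1) - C κ * chebU κ k

theorem chebU_eval (κ p r : K) (h : p * r = κ) (k : ℕ) :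
    (p - r) * (chebU κ k).eval (p + r) = p ^ (k + 1) - r ^ (k + 1) := by
  induction k using Nat.twoStepInduction with
  | zero => simp [chebU]
  | one => simp [chebU]; ring
  | more k ih1 ih2 =>
    simp only [chebU, Polynomial.eval_sub, Polynomial.eval_mul, Polynomial.eval_X,
      Polynomial.eval_C]
    linear_combination ((chebU κ k).eval (p + r)) * (p - r) * h + (p + r) * ih2 - p * r * ih1

theorem chebU_monic_natDegree (κ : K) (k : ℕ) : (chebU κ k).Monic ∧ (chebU κ k).natDegree = k := by
  induction k using Nat.twoStepInduction with
  | zero => simp [chebU]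
  | one => simp [chebU]
  | more k ih1 ih2 =>
    have hm : (Polynomial.X * chebU κ (k + 1)).Monic := Polynomial.monic_X.mul ih2.1
    have hd : (Polynomial.X * chebU κ (k + 1)).natDegree = k + 2 := by
      rw [Polynomial.natDegree_X_mul ih2.1.ne_zero, ih2.2]
    have hlt : (Polynomial.C κ * chebU κ k).natDegree < k + 2 :=
      (Polynomial.natDegree_C_mul_le _ _).trans_lt (by omega)
    have hlt' : (Polynomial.C κ * chebU κ k).degree < (Polynomial.X * chebU κ (k + 1)).degree :=
      Polynomial.degree_lt_degree (by omega)
    refine ⟨hm.sub_of_left hlt', ?_⟩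
    rw [chebU, Polynomial.natDegree_sub_eq_left_of_natDegree_lt (by omega), hd]

theorem det_pow_sub_pow {n : ℕ} (κ : K) (p r : Fin n → K) (h : ∀ j, p j * r j = κ) :
    Matrix.det (Matrix.of fun i j : Fin n => p j ^ ((i : ℕ) + 1) - r j ^ ((i : ℕ) + 1)) =
      (∏ j, (p j - r j)) * ∏ i, ∏ j ∈ Finset.Ioi i, (p j + r j - (p i + r i)) := by
  rw [← Matrix.det_vandermonde (fun j => p j + r j),
    Matrix.det_eval_matrixOfPolynomials_eq_det_vandermonde _ (fun i : Fin n => chebU κ i)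
      (fun i => (chebU_monic_natDegree κ i).2) (fun i => (chebU_monic_natDegree κ i).1),
    ← Matrix.det_transpose (Matrix.of fun i j : Fin n => (chebU κ j).eval (p i + r i)),
    ← Matrix.det_mul_row]
  refine congrArg Matrix.det ?_
  ext i j
  simp [chebU_eval κ _ _ (h j)]

theorem rectAlternant_pow (t : K) (c n : ℕ) :
    rectAlternant (c + n) (fun i : Fin n => t ^ ((i : ℕ) + 1)) =
      ∏ j ∈ Finset.range n, (t ^ (n - 1 - j) * (1 - t ^ (c + 2 * j + 1)) *
        ∏ i ∈ Finset.range j,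
          (t ^ (n - 1 - j) * (1 - t ^ (j - i)) * (1 - t ^ (c + i + j + 1)))) := by
  rw [Finset.prod_mul_distrib, ← prod_prod_Ioi_eq n (fun i j =>
    (t ^ (n - 1 - j) * (1 - t ^ (j - i)) * (1 - t ^ (c + i + j + 1)))),
    Finset.prod_range]
  have h := det_pow_sub_pow (n := n) (t ^ (c + 2 * n - 1)) (fun j => t ^ (j.rev : ℕ))
    (fun j => t ^ (c + n + j)) (fun j => by
      rw [← pow_add, Fin.val_rev]
      congr 1
      omega)
  have h1 : rectAlternant (c + n) (fun i : Fin n => t ^ ((i : ℕ) + 1)) = Matrix.det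
    (Matrix.of fun i j : Fin n =>
      (t ^ (j.rev : ℕ)) ^ ((i : ℕ) + 1) - (t ^ (c + n + j)) ^ ((i : ℕ) + 1)) := by
    refine congrArg Matrix.det ?_
    ext i j
    simp only [Matrix.of_apply, ← pow_mul, mul_comm]
  rw [h1, h]
  congr 1
  · refine Finset.prod_congr rfl fun j _ => ?_
    rw [mul_sub, ← pow_add, mul_one, Fin.val_rev]
    congr 2 <;> omega
  · refine Finset.prod_congr rfl fun i _ => Finset.prod_congr rfl fun j hj => ?_
    have hij : (i : ℕ) < j := Fin.lt_def.1 (Finset.mem_Ioi.1 hj)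
    have hjn := j.2
    rw [Fin.val_rev, Fin.val_rev]
    obtain ⟨d, hd⟩ := Nat.exists_eq_add_of_lt hij
    obtain ⟨e, he⟩ := Nat.exists_eq_add_of_lt hjn
    rw [show n - (j + 1 : ℕ) = e by omega, show n - 1 - (j : ℕ) = e by omega,
      show n - (i + 1 : ℕ) = e + (d + 1) by omega, show (j : ℕ) - i = d + 1 by omega,
      show c + n + (j : ℕ) = e + ((d + 1) + (c + i + j + 1)) by omega,
      show c + n + (i : ℕ) = e + (c + i + j + 1) by omega]
    generalize c + (i : ℕ) + j + 1 = m
    ring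

/-- The constant relating the tableau sum of a fixed shape to an alternant. -/
def shapeConst (t : K) (n : ℕ) : K :=
  ∏ m ∈ Finset.range n, (t ^ (∑ i ∈ Finset.range m, (i + 1)) *
    ∏ j ∈ Finset.range m, (1 - t ^ (j + 1)))

theorem prod_pow_eq (t : K) (n : ℕ) :
    ∏ j ∈ Finset.range n, (t ^ (n - 1 - j)) ^ (j + 1) =
      ∏ m ∈ Finset.range n, t ^ (∑ i ∈ Finset.range m, (i + 1)) := by
  induction n with
  | zero => simp
  | succ n ih =>
    rw [Finset.prod_range_succ _ n, Finset.prod_range_succ _ n, ← ih,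
      ← Finset.prod_pow_eq_pow_sum, ← Finset.prod_mul_distrib]
    simp only [Nat.add_sub_cancel, Nat.sub_self, pow_zero, one_pow, mul_one]
    refine Finset.prod_congr rfl fun j hj => ?_
    have := Finset.mem_range.1 hj
    rw [show n - j = n - 1 - j + 1 by omega, pow_succ t, mul_pow]

theorem rectAlternant_pow_eq (t : K) (c n : ℕ) :
    rectAlternant (c + n) (fun i : Fin n => t ^ ((i : ℕ) + 1)) =
      shapeConst t n * ∏ j ∈ Finset.range n, ∏ i ∈ Finset.range (j + 1),
        (1 - t ^ (c + (j + 1) + i)) := by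
  rw [rectAlternant_pow, shapeConst,
    Finset.prod_mul_distrib (f := fun m => t ^ (∑ i ∈ Finset.range m, (i + 1))), ← prod_pow_eq,
    ← Finset.prod_mul_distrib, ← Finset.prod_mul_distrib]
  refine Finset.prod_congr rfl fun j _ => ?_
  rw [Finset.prod_mul_distrib, Finset.prod_mul_distrib, Finset.prod_range_succ _ j,
    Finset.prod_const, Finset.card_range, ← Finset.prod_range_reflect (fun i => 1 - t ^ (i + 1))]
  have h1 : ∏ i ∈ Finset.range j, (1 - t ^ (j - i)) =
      ∏ i ∈ Finset.range j, (1 - t ^ (j - 1 - i + 1)) := by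
    refine Finset.prod_congr rfl fun i hi => ?_
    have := Finset.mem_range.1 hi
    congr 2
    omega
  have h2 : ∏ i ∈ Finset.range j, (1 - t ^ (c + i + j + 1)) =
      ∏ i ∈ Finset.range j, (1 - t ^ (c + (j + 1) + i)) := by
    refine Finset.prod_congr rfl fun i _ => ?_
    congr 2
    omega
  rw [h1, h2, show c + 2 * j + 1 = c + (j + 1) + j by omega, pow_succ]
  ring

theorem alternantSum_pow (t : K) (ht0 : t ≠ 0) (ht : ∀ k, t ^ (k + 1) ≠ 1) (c n : ℕ) :
    alternantSum (c + n) (fun i : Fin n => t ^ ((i : ℕ) + 1)) *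
      ∏ j ∈ Finset.range n, ∏ i ∈ Finset.range (j + 1), (1 - t ^ (j + 1 + i)) =
    shapeConst t n * ∏ j ∈ Finset.range n, ∏ i ∈ Finset.range (j + 1),
        (1 - t ^ (c + (j + 1) + i)) := by
  have hlt : ∀ a b : ℕ, a < b → t ^ a ≠ t ^ b := by
    intro a b hab h
    obtain ⟨d, rfl⟩ := Nat.exists_eq_add_of_lt hab
    refine ht d (mul_left_cancel₀ (pow_ne_zero a ht0) ?_)
    rw [mul_one, ← pow_add, ← add_assoc, ← h]
  have key := alternantSum_mul (c + n) (fun i : Fin n => t ^ ((i : ℕ) + 1))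
    (fun i => pow_ne_zero _ ht0)
    (fun i j hij => by
      rcases lt_trichotomy (i : ℕ) j with h | h | h
      · exact absurd hij (hlt _ _ (by omega))
      · exact Fin.ext h
      · exact absurd hij.symm (hlt _ _ (by omega)))
    (fun i h => ht (2 * i + 1) (by
      rw [show 2 * (i : ℕ) + 1 + 1 = (i + 1) * 2 by ring, pow_mul]
      replace h : t ^ ((i : ℕ) + 1) = -1 := h
      rw [h]
      ring))
  rw [rectAlternant_pow_eq] at key
  rw [← key, pairProd]
  simp only [← pow_add]
  rw [prod_prod_Ioi_eq n (fun i j => 1 - t ^ (i + 1 + (j + 1))),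
    ← Finset.prod_range (fun i => 1 - t ^ (i + 1)), ← Finset.prod_mul_distrib]
  congr 1
  refine Finset.prod_congr rfl fun j _ => ?_
  rw [Finset.prod_range_succ', mul_comm]
  congr 1
  refine Finset.prod_congr rfl fun i _ => ?_
  congr 2
  omega

end PrincipalSpecialization

theorem StrictAnti.le_add_succ {n : ℕ} {l : Fin n → ℕ} (hl : StrictAnti l) (i : Fin n) :
    n ≤ l i + i + 1 := by
  have h : ∀ k, ∀ i : Fin n, (i : ℕ) + k + 1 = n → k ≤ l i := by
    intro k
    induction k with
    | zero => exact fun _ _ => Nat.zero_le _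
    | succ k ih =>
      intro i hi
      have h1 := ih ⟨i + 1, by omega⟩ (by simp only; omega)
      have h2 : l ⟨i + 1, by omega⟩ < l i := hl (Fin.lt_def.2 (by simp))
      omega
  have := h (n - 1 - i) i (by omega)
  omega

theorem strictAnti_of_interlacing {n : ℕ} {l : Fin (n + 1) → ℕ} {m : Fin n → ℕ}
    (h : ∀ i : Fin n, l i.succ ≤ m i ∧ m i < l i.castSucc) : StrictAnti m := by
  cases n with
  | zero => exact Subsingleton.strictAnti _
  | succ n =>
    refine Fin.strictAnti_iff_succ_lt.2 fun i => ?_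
    have h1 := (h i.succ).2
    have h2 := (h i.castSucc).1
    rw [Fin.succ_castSucc] at h2
    omega

namespace SPP

theorem eq_of_part {P Q : SPP} (h : ∀ i j, P.part i j = Q.part i j) : P = Q := by
  have : P.part = Q.part := by
    funext i j
    exact h i j
  cases P
  cases Q
  cases this
  rfl

theorem part_add_le (P : SPP) (i j : ℕ) (h : P.part i j ≠ 0) : P.part i j + i ≤ P.part 0 j := by
  induction i with
  | zero => simp
  | succ i ih =>
    have := P.col_strict i j h
    have := ih (by omega)
    omega

theorem part_eq_zero {P : SPP} {n : ℕ} (h : ∀ i j, P.part i j ≤ n) {i : ℕ} (hi : n ≤ i) (j : ℕ) :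
    P.part i j = 0 := by
  by_contra h0
  have := P.part_add_le i j h0
  have := h 0 j
  omega

theorem part_ne_zero_of_le (P : SPP) {i i' : ℕ} (h : i ≤ i') {j : ℕ} (h0 : P.part i' j ≠ 0) :
    P.part i j ≠ 0 := by
  induction i', h using Nat.le_induction with
  | base => exact h0
  | succ k _ ih =>
    have := P.col_strict k j h0
    exact ih (by omega)

theorem exists_row (P : SPP) (i : ℕ) : ∃ r, ∀ j, P.part i j ≠ 0 ↔ j < r := by
  have hex : ∃ j, P.part i j = 0 := by
    by_contra! h
    have hf : (Set.range fun j : ℕ => (i, j)).Finite := by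
      refine P.supp_finite.subset ?_
      rintro _ ⟨j, rfl⟩
      exact h j
    exact Set.infinite_range_of_injective (fun a b hab => (Prod.mk.inj hab).2) hf
  classical
  refine ⟨Nat.find hex, fun j => ⟨fun h => ?_, fun h => Nat.find_min hex h⟩⟩
  by_contra! hj
  have := P.row_decr i _ _ hj
  rw [Nat.find_spec hex] at this
  omega

/-- Subtract one from every part. -/
def lower (P : SPP) : SPP where
  part i j := P.part i j - 1
  supp_finite := P.supp_finite.subset fun ij h => by
    simp only [Set.mem_ofPred_eq] at h ⊢
    omega
  row_decr i j₁ j₂ h := Nat.sub_le_sub_right (P.row_decr i j₁ j₂ h) 1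
  col_strict i j h := by
    have := P.col_strict i j (by omega)
    omega

theorem lower_part (P : SPP) (i j : ℕ) : P.lower.part i j = P.part i j - 1 := rfl

/-- Strict plane partitions with parts at most `n` and at most `c` columns. -/
def bounded (n c : ℕ) : Set SPP :=
  {P : SPP | (∀ i j, P.part i j ≤ n) ∧ (∀ i j, c ≤ j → P.part i j = 0)}

theorem bounded_finite (n c : ℕ) : (bounded n c).Finite := by
  refine Set.Finite.of_finite_image (f := fun P (i : Fin n) (j : Fin c) =>
    (Fin.ofNat (n + 1) (P.part i j))) (Set.toFinite _) ?_
  intro P hP Q hQ hPQ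
  refine eq_of_part fun i j => ?_
  by_cases hi : n ≤ i
  · rw [part_eq_zero hP.1 hi, part_eq_zero hQ.1 hi]
  by_cases hj : c ≤ j
  · rw [hP.2 i j hj, hQ.2 i j hj]
  have := congrArg Fin.val (congrFun (congrFun hPQ ⟨i, by omega⟩) ⟨j, by omega⟩)
  simp only [Fin.ofNat] at this
  rwa [Nat.mod_eq_of_lt (Nat.lt_succ_of_le (hP.1 i j)),
    Nat.mod_eq_of_lt (Nat.lt_succ_of_le (hQ.1 i j))] at this

/-- Strict plane partitions with parts at most `n` and row lengths `l i - (n - 1 - i)`. -/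
def ofShape (n : ℕ) (l : Fin n → ℕ) : Set SPP :=
  {P : SPP | (∀ i j, P.part i j ≤ n) ∧ ∀ (i : Fin n) j, P.part i j ≠ 0 ↔ j + n < l i + i + 1}

theorem ofShape_finite (n : ℕ) (l : Fin n → ℕ) : (ofShape n l).Finite := by
  refine (bounded_finite n (∑ i, l i)).subset fun P hP => ⟨hP.1, fun i j hj => ?_⟩
  by_cases hi : n ≤ i
  · exact part_eq_zero hP.1 hi j
  · by_contra h0
    have h1 := (hP.2 ⟨i, by omega⟩ j).1 h0
    have h2 := Finset.single_le_sum (f := l) (fun _ _ => Nat.zero_le _)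
      (Finset.mem_univ ⟨i, by omega⟩)
    simp only at h1
    omega

/-- The finite set of elements of `ofShape`. -/
noncomputable def shapeFinset (n : ℕ) (l : Fin n → ℕ) : Finset SPP := (ofShape_finite n l).toFinset

theorem mem_shapeFinset {n : ℕ} {l : Fin n → ℕ} {P : SPP} :
    P ∈ shapeFinset n l ↔ P ∈ ofShape n l := by
  simp [shapeFinset]

theorem exists_mem_ofShape {P : SPP} {n : ℕ} (h : ∀ i j, P.part i j ≤ n) :
    ∃ l : Fin n → ℕ, StrictAnti l ∧ P ∈ ofShape n l := by
  choose r hr using P.exists_row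
  refine ⟨fun i => r i + (n - 1 - i), fun i i' hi => ?_, h, fun i j => ?_⟩
  · have h1 : r i' ≤ r i := by
      by_contra! hlt
      have := P.part_ne_zero_of_le (i := i) (i' := i') (le_of_lt hi) ((hr i' (r i)).2 hlt)
      exact lt_irrefl _ ((hr i _).1 this)
    have := Fin.lt_def.1 hi
    simp only
    omega
  · rw [hr]
    have := i.2
    simp only
    omega

theorem ofShape_injective {n : ℕ} {l m : Fin n → ℕ} (hl : StrictAnti l) (hm : StrictAnti m)
    {P : SPP} (h1 : P ∈ ofShape n l) (h2 : P ∈ ofShape n m) : l = m := by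
  funext i
  have e : ∀ j, j + n < l i + i + 1 ↔ j + n < m i + i + 1 := fun j => by
    rw [← h1.2 i j, ← h2.2 i j]
  have := hl.le_add_succ i
  have := hm.le_add_succ i
  have := e (l i + i - n)
  have := e (m i + i - n)
  omega

theorem lower_injOn {n : ℕ} (l : Fin n → ℕ) : Set.InjOn lower (ofShape n l) := by
  intro P hP Q hQ h
  refine eq_of_part fun i j => ?_
  by_cases hi : n ≤ i
  · rw [part_eq_zero hP.1 hi, part_eq_zero hQ.1 hi]
  have h1 := hP.2 ⟨i, by omega⟩ j
  have h2 := hQ.2 ⟨i, by omega⟩ j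
  have h3 : P.part i j - 1 = Q.part i j - 1 := by rw [← lower_part, h, lower_part]
  simp only at h1 h2
  omega

theorem lower_mem {n : ℕ} {l : Fin (n + 1) → ℕ} (hl : StrictAnti l) {P : SPP}
    (hP : P ∈ ofShape (n + 1) l) :
    ∃ m : Fin n → ℕ, (∀ i : Fin n, l i.succ ≤ m i ∧ m i < l i.castSucc) ∧
      P.lower ∈ ofShape n m := by
  obtain ⟨m, hm, hQ⟩ := exists_mem_ofShape (P := P.lower) (n := n) fun i j => by
    have := hP.1 i j
    rw [lower_part]
    omega
  refine ⟨m, fun i => ⟨?_, ?_⟩, hQ⟩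
  · by_contra! hlt
    have h1 := hm.le_add_succ i
    have h2 := (hP.2 i.succ (l i.succ + i - n)).2 (by rw [Fin.val_succ]; omega)
    rw [Fin.val_succ] at h2
    have h3 := P.col_strict _ _ h2
    have h4 := (hQ.2 i (l i.succ + i - n)).1 (by rw [lower_part]; omega)
    omega
  · by_contra! hlt
    have h1 := hl.le_add_succ i.castSucc
    rw [Fin.val_castSucc] at h1
    have h2 := (hQ.2 i (m i + i - n)).2 (by omega)
    rw [lower_part] at h2
    have h3 := (hP.2 i.castSucc (m i + i - n)).1 (by rw [Fin.val_castSucc]; omega)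
    rw [Fin.val_castSucc] at h3
    omega

theorem exists_lower_eq {n : ℕ} {l : Fin (n + 1) → ℕ} {m : Fin n → ℕ}
    (h : ∀ i : Fin n, l i.succ ≤ m i ∧ m i < l i.castSucc) {Q : SPP} (hQ : Q ∈ ofShape n m) :
    ∃ P ∈ ofShape (n + 1) l, P.lower = Q := by
  classical
  set L : ℕ → ℕ := fun i => if hi : i < n + 1 then l ⟨i, hi⟩ + i - n else 0 with hL
  have hLi : ∀ i : Fin (n + 1), L i = l i + i - n := fun i => by
    rw [hL]
    simp only [i.2, dif_pos]
  have hQL : ∀ i j, Q.part i j ≠ 0 → j < L i := by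
    intro i j h0
    by_cases hi : n ≤ i
    · exact absurd (part_eq_zero hQ.1 hi j) h0
    · have h1 := (hQ.2 ⟨i, by omega⟩ j).1 h0
      have h2 := (h ⟨i, by omega⟩).2
      have h3 := hLi (Fin.castSucc ⟨i, by omega⟩)
      simp only [Fin.val_castSucc] at h1 h2 h3
      omega
  have hLQ : ∀ i j, j < L (i + 1) → Q.part i j ≠ 0 := by
    intro i j h0
    by_cases hi : n ≤ i
    · simp [hL, show ¬ i < n by omega] at h0
    · refine (hQ.2 ⟨i, by omega⟩ j).2 ?_
      have h2 := (h ⟨i, by omega⟩).1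
      have h3 := hLi (Fin.succ ⟨i, by omega⟩)
      simp only [Fin.val_succ] at h2 h3 ⊢
      omega
  refine ⟨⟨fun i j => if j < L i then Q.part i j + 1 else 0, ?_, ?_, ?_⟩, ⟨?_, ?_⟩, ?_⟩
  · refine (((Finset.range (n + 1)).sigma fun i => Finset.range (L i)).image
      fun x => (x.1, x.2)).finite_toSet.subset ?_
    rintro ⟨i, j⟩ hij
    simp only [Set.mem_ofPred_eq] at hij
    have hj : j < L i := by
      by_contra hj
      simp [hj] at hij
    have hi : i < n + 1 := by
      by_contra hi
      rw [hL] at hj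
      simp only [dif_neg hi] at hj
      omega
    simp only [Finset.coe_image, Set.mem_image, Finset.mem_coe, Finset.mem_sigma, Finset.mem_range]
    exact ⟨⟨i, j⟩, ⟨hi, hj⟩, rfl⟩
  · intro i j₁ j₂ hj
    have := Q.row_decr i j₁ j₂ hj
    split_ifs <;> omega
  · intro i j h0
    have hj : j < L (i + 1) := by
      by_contra hj
      simp [hj] at h0
    have h1 := hLQ i j hj
    have h2 := hQL i j h1
    have h3 := Q.col_strict i j
    simp only [hj, h2, if_true]
    omega
  · intro i j
    have := hQ.1 i j
    simp only
    split_ifs <;> omega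
  · intro i j
    simp only [hLi]
    split_ifs <;> omega
  · refine eq_of_part fun i j => ?_
    have := hQL i j
    simp only [lower_part]
    split_ifs <;> omega

theorem sppNorm_eq {n : ℕ} {l : Fin (n + 1) → ℕ} (hl : StrictAnti l) {P : SPP}
    (hP : P ∈ ofShape (n + 1) l) :
    sppNorm P + ∑ i ∈ Finset.range n, (i + 1) = sppNorm P.lower + ∑ i, l i := by
  have hs : ∀ ij : ℕ × ℕ, P.part ij.1 ij.2 ≠ 0 →
      ij ∈ Finset.range (n + 1) ×ˢ Finset.range (l 0 + 1) := by
    rintro ⟨i, j⟩ h0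
    have h1 := (hP.2 0 j).1 (P.part_ne_zero_of_le (Nat.zero_le i) h0)
    have h2 : i < n + 1 := by
      by_contra! hi
      exact h0 (part_eq_zero hP.1 hi j)
    rw [Finset.mem_product, Finset.mem_range, Finset.mem_range]
    simp only [Fin.val_zero] at h1 ⊢
    omega
  have e1 : sppNorm P = ∑ ij ∈ Finset.range (n + 1) ×ˢ Finset.range (l 0 + 1),
      P.part ij.1 ij.2 :=
    finsum_eq_sum_of_support_subset _ fun ij h => hs ij h
  have e2 : sppNorm P.lower = ∑ ij ∈ Finset.range (n + 1) ×ˢ Finset.range (l 0 + 1),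
      P.lower.part ij.1 ij.2 :=
    finsum_eq_sum_of_support_subset _ fun ij h => hs ij (by
      rw [Function.mem_support, lower_part] at h
      omega)
  have e3 : sppNorm P = sppNorm P.lower + ∑ i : Fin (n + 1), (l i + i - n) := by
    rw [e1, e2, Finset.sum_product, Finset.sum_product, Finset.sum_range, Finset.sum_range,
      ← Finset.sum_add_distrib]
    refine Finset.sum_congr rfl fun i _ => ?_
    have h1 : l i + i - n = ∑ j ∈ Finset.range (l 0 + 1), if j < l i + i - n then 1 else 0 := by
      have h0 : l i ≤ l 0 := hl.antitone (Fin.zero_le i)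
      have hi := i.2
      rw [← Finset.sum_filter, Finset.sum_const, smul_eq_mul, mul_one]
      have : {j ∈ Finset.range (l 0 + 1) | j < l i + i - n} = Finset.range (l i + i - n) := by
        ext j
        simp only [Finset.mem_filter, Finset.mem_range]
        omega
      rw [this, Finset.card_range]
    rw [h1, ← Finset.sum_add_distrib]
    refine Finset.sum_congr rfl fun j _ => ?_
    have h2 := hP.2 i j
    simp only [lower_part]
    split_ifs <;> omega
  have e4 : ∑ i : Fin (n + 1), (l i + i - n) + ∑ i : Fin (n + 1), (n - i) = ∑ i, l i := by
    rw [← Finset.sum_add_distrib]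
    refine Finset.sum_congr rfl fun i _ => ?_
    have := hl.le_add_succ i
    omega
  have e5 : ∑ i : Fin (n + 1), (n - i) = ∑ i ∈ Finset.range n, (i + 1) := by
    rw [← Finset.sum_range (fun i => n - i), Finset.sum_range_succ, Nat.sub_self, add_zero,
      ← Finset.sum_range_reflect (fun i => i + 1)]
    refine Finset.sum_congr rfl fun i hi => ?_
    have := Finset.mem_range.1 hi
    omega
  omega

theorem sum_lower {K : Type*} [AddCommMonoid K] {n : ℕ} {l : Fin (n + 1) → ℕ} (hl : StrictAnti l)
    (f : SPP → K) :
    ∑ P ∈ shapeFinset (n + 1) l, f P.lower =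
      ∑ m ∈ Fintype.piFinset fun i : Fin n => Finset.Ico (l i.succ) (l i.castSucc),
        ∑ P ∈ shapeFinset n m, f P := by
  classical
  have hmem : ∀ m : Fin n → ℕ, m ∈ (Fintype.piFinset fun i : Fin n =>
      Finset.Ico (l i.succ) (l i.castSucc)) ↔ ∀ i : Fin n, l i.succ ≤ m i ∧ m i < l i.castSucc := by
    simp
  rw [← Finset.sum_biUnion, ← Finset.sum_image (f := f) (g := lower)]
  · congr 1
    ext Q
    simp only [Finset.mem_image, Finset.mem_biUnion, mem_shapeFinset, hmem]
    constructor
    · rintro ⟨P, hP, rfl⟩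
      exact lower_mem hl hP
    · rintro ⟨m, hm, hQ⟩
      exact exists_lower_eq hm hQ
  · exact fun P hP Q hQ h => lower_injOn l (mem_shapeFinset.1 hP) (mem_shapeFinset.1 hQ) h
  · intro m hm m' hm' hne
    refine Finset.disjoint_left.2 fun P hP hP' => hne ?_
    exact ofShape_injective (strictAnti_of_interlacing ((hmem m).1 hm))
      (strictAnti_of_interlacing ((hmem m').1 hm')) (mem_shapeFinset.1 hP) (mem_shapeFinset.1 hP')

end SPP

section ShapeSum

variable {K : Type*} [Field K]

theorem det_interlacing_sum (t : K) {n : ℕ} {l : Fin (n + 1) → ℕ} (hl : StrictAnti l) :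
    t ^ (∑ i, l i) * ((∏ j ∈ Finset.range n, (1 - t ^ (j + 1))) *
      ∑ m ∈ Fintype.piFinset fun i : Fin n => Finset.Ico (l i.succ) (l i.castSucc),
        Matrix.det (Matrix.of fun i j : Fin n => (t ^ ((i : ℕ) + 1)) ^ m j)) =
    Matrix.det (Matrix.of fun i j : Fin (n + 1) => (t ^ ((i : ℕ) + 1)) ^ l j) := by
  have h1 : ∑ m ∈ Fintype.piFinset fun i : Fin n => Finset.Ico (l i.succ) (l i.castSucc),
      Matrix.det (Matrix.of fun i j : Fin n => (t ^ ((i : ℕ) + 1)) ^ m j) =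
      Matrix.det (Matrix.of fun i j : Fin n =>
        ∑ k ∈ Finset.Ico (l i.succ) (l i.castSucc), (t ^ ((j : ℕ) + 1)) ^ k) := by
    have h := MultilinearMap.map_sum_finset (α := fun _ : Fin n => ℕ)
      (Matrix.detRowAlternating (n := Fin n) (R := K)).toMultilinearMap
      (fun _ k j => (t ^ ((j : ℕ) + 1)) ^ k) (fun i : Fin n => Finset.Ico (l i.succ) (l i.castSucc))
    have h' : Matrix.det (Matrix.of fun i j : Fin n =>
        ∑ k ∈ Finset.Ico (l i.succ) (l i.castSucc), (t ^ ((j : ℕ) + 1)) ^ k) =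
        (Matrix.detRowAlternating (n := Fin n) (R := K)).toMultilinearMap
        (fun i => ∑ k ∈ Finset.Ico (l i.succ) (l i.castSucc),
          fun j : Fin n => (t ^ ((j : ℕ) + 1)) ^ k) := by
      refine congrArg Matrix.det ?_
      ext i j
      simp
    rw [h', h]
    refine Finset.sum_congr rfl fun m _ => ?_
    rw [← Matrix.det_transpose]
    rfl
  have h2 : (∏ j ∈ Finset.range n, (1 - t ^ (j + 1))) * Matrix.det (Matrix.of fun i j : Fin n =>
        ∑ k ∈ Finset.Ico (l i.succ) (l i.castSucc), (t ^ ((j : ℕ) + 1)) ^ k) =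
      Matrix.det (Matrix.of fun i j : Fin n =>
        (t ^ ((j : ℕ) + 1)) ^ l i.succ - (t ^ ((j : ℕ) + 1)) ^ l i.castSucc) := by
    rw [Finset.prod_range, ← Matrix.det_mul_row]
    refine congrArg Matrix.det ?_
    ext i j
    simp only [Matrix.of_apply]
    have := geom_sum_Ico_mul_neg (t ^ ((j : ℕ) + 1))
      (hl (Fin.castSucc_lt_succ (i := i))).le
    rw [mul_comm, this]
  have h3 : Matrix.det (Matrix.of fun i j : Fin (n + 1) => (t ^ (j : ℕ)) ^ l i) =
      Matrix.det (Matrix.of fun i j : Fin n =>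
        (t ^ ((j : ℕ) + 1)) ^ l i.succ - (t ^ ((j : ℕ) + 1)) ^ l i.castSucc) := by
    rw [Matrix.det_eq_of_forall_row_eq_smul_add_pred
      (B := Matrix.of fun i j : Fin (n + 1) => Fin.cases ((t ^ (j : ℕ)) ^ l 0)
        (fun i => (t ^ (j : ℕ)) ^ l i.succ - (t ^ (j : ℕ)) ^ l i.castSucc) i) (fun _ => 1)
      (fun j => by simp) (fun i j => by simp), Matrix.det_succ_column_zero, Fin.sum_univ_succ]
    simp only [Fin.val_zero, pow_zero, one_pow, Matrix.of_apply, Fin.cases_zero, Fin.cases_succ,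
      sub_self, mul_zero, zero_mul, Finset.sum_const_zero, add_zero, one_mul]
    refine congrArg Matrix.det ?_
    ext i j
    simp
  rw [h1, h2, ← h3, ← Finset.prod_pow_eq_pow_sum, ← Matrix.det_mul_column,
    ← Matrix.det_transpose]
  refine congrArg Matrix.det ?_
  ext i j
  simp only [Matrix.transpose_apply, Matrix.of_apply]
  rw [← mul_pow, pow_succ' t]

theorem shapeConst_mul_sum (t : K) {n : ℕ} {l : Fin n → ℕ} (hl : StrictAnti l) :
    shapeConst t n * ∑ P ∈ SPP.shapeFinset n l, t ^ sppNorm P =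
      Matrix.det (Matrix.of fun i j : Fin n => (t ^ ((i : ℕ) + 1)) ^ l j) := by
  induction n with
  | zero =>
    let Z : SPP := ⟨fun _ _ => 0, by simp, fun _ _ _ _ => le_rfl, fun _ _ h => absurd rfl h⟩
    have hZ : SPP.shapeFinset 0 l = {Z} := by
      ext P
      rw [SPP.mem_shapeFinset, Finset.mem_singleton]
      constructor
      · exact fun hP => SPP.eq_of_part fun i j => Nat.le_zero.1 (hP.1 i j)
      · rintro rfl
        exact ⟨fun _ _ => le_rfl, fun i => i.elim0⟩
    have hn : sppNorm Z = 0 := by simp [sppNorm, Z]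
    simp [hZ, hn, shapeConst]
  | succ n ih =>
    rw [← det_interlacing_sum t hl]
    have h1 : ∑ m ∈ Fintype.piFinset fun i : Fin n => Finset.Ico (l i.succ) (l i.castSucc),
        Matrix.det (Matrix.of fun i j : Fin n => (t ^ ((i : ℕ) + 1)) ^ m j) =
        shapeConst t n * ∑ P ∈ SPP.shapeFinset (n + 1) l, t ^ sppNorm P.lower := by
      rw [SPP.sum_lower hl (fun P => t ^ sppNorm P), Finset.mul_sum]
      refine Finset.sum_congr rfl fun m hm =>
        (ih (strictAnti_of_interlacing (l := l) fun i => ?_)).symm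
      exact Finset.mem_Ico.1 (Fintype.mem_piFinset.1 hm i)
    have h2 : t ^ (∑ i ∈ Finset.range n, (i + 1)) * ∑ P ∈ SPP.shapeFinset (n + 1) l, t ^ sppNorm P =
        t ^ (∑ i, l i) * ∑ P ∈ SPP.shapeFinset (n + 1) l, t ^ sppNorm P.lower := by
      rw [Finset.mul_sum, Finset.mul_sum]
      refine Finset.sum_congr rfl fun P hP => ?_
      rw [← pow_add, ← pow_add, add_comm, SPP.sppNorm_eq hl (SPP.mem_shapeFinset.1 hP), add_comm]
    rw [h1, shapeConst, Finset.prod_range_succ]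
    change shapeConst t n * _ * _ = _
    linear_combination shapeConst t n * (∏ j ∈ Finset.range n, (1 - t ^ (j + 1))) * h2

theorem sum_bounded_eq (n c : ℕ) (f : SPP → K) :
    ∑ P ∈ (SPP.bounded_finite n c).toFinset, f P =
      ∑ l ∈ strictSeqs n (c + n), ∑ P ∈ SPP.shapeFinset n l, f P := by
  classical
  rw [← Finset.sum_biUnion]
  · congr 1
    ext P
    simp only [Set.Finite.mem_toFinset, Finset.mem_biUnion, mem_strictSeqs, SPP.mem_shapeFinset]
    constructor
    · intro hP
      obtain ⟨l, hl, hPl⟩ := SPP.exists_mem_ofShape hP.1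
      refine ⟨l, ⟨fun i => ?_, hl⟩, hPl⟩
      by_contra! hi
      exact (hPl.2 i c).2 (by omega) (hP.2 i c le_rfl)
    · rintro ⟨l, ⟨hlt, -⟩, hP⟩
      refine ⟨hP.1, fun i j hj => ?_⟩
      by_contra h0
      have hi : i < n := by
        by_contra! hi
        exact h0 (SPP.part_eq_zero hP.1 hi j)
      have h1 := (hP.2 ⟨0, by omega⟩ j).1 (P.part_ne_zero_of_le (Nat.zero_le i) h0)
      have h2 := hlt ⟨0, by omega⟩
      simp only at h1
      omega
  · intro l hl m hm hne
    refine Finset.disjoint_left.2 fun P hP hP' => hne ?_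
    exact SPP.ofShape_injective (mem_strictSeqs.1 hl).2 (mem_strictSeqs.1 hm).2
      (SPP.mem_shapeFinset.1 hP) (SPP.mem_shapeFinset.1 hP')

end ShapeSum

theorem q_ne_zero : q ≠ 0 := RatFunc.X_ne_zero

theorem q_pow_ne_one (k : ℕ) : q ^ (k + 1) ≠ 1 := by
  intro h
  have h1 : (algebraMap (Polynomial ℚ) (RatFunc ℚ)) (Polynomial.X ^ (k + 1)) =
      algebraMap (Polynomial ℚ) (RatFunc ℚ) 1 := by
    rw [map_pow, RatFunc.algebraMap_X, map_one]
    exact h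
  have h2 := congrArg Polynomial.natDegree (RatFunc.algebraMap_injective ℚ h1)
  simp at h2

theorem qfac_div_qfac (c j : ℕ) :
    qfac ((c : ℤ) + ((j + 1 : ℕ) : ℤ)) (j + 1) / qfac ((j + 1 : ℕ) : ℤ) (j + 1) =
      (∏ i ∈ Finset.range (j + 1), (1 - q ^ (c + (j + 1) + i))) /
        ∏ i ∈ Finset.range (j + 1), (1 - q ^ (j + 1 + i)) := by
  have hq : 1 - q ≠ 0 := sub_ne_zero.2 fun h => q_pow_ne_one 0 (by simpa using h.symm)
  rw [qfac, qfac, ← Finset.prod_div_distrib, ← Finset.prod_div_distrib]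
  refine Finset.prod_congr rfl fun i _ => ?_
  rw [qb, qb, div_div_div_cancel_right₀ hq]
  norm_cast

/-- **Bender–Knuth (ex-)Conjecture.** The generating function of strict plane partitions
with parts in `{1,…,n}` and at most `c` columns is `∏_{i=1}^n [c+i;q]_i/[i;q]_i`. -/
theorem benderKnuth (n c : ℕ) (hn : 1 ≤ n) :
    ∃ hfin : {P : SPP | (∀ i j, P.part i j ≤ n) ∧ (∀ i j, c ≤ j → P.part i j = 0)}.Finite,
      ∑ P ∈ hfin.toFinset, q ^ sppNorm P =
        ∏ i ∈ Finset.Icc 1 n, qfac (c + i) i / qfac i i := by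
  refine ⟨SPP.bounded_finite n c, ?_⟩
  have hK : shapeConst q n ≠ 0 := by
    refine Finset.prod_ne_zero_iff.2 fun m _ => mul_ne_zero (pow_ne_zero _ q_ne_zero) ?_
    exact Finset.prod_ne_zero_iff.2 fun j _ => sub_ne_zero.2 (q_pow_ne_one j).symm
  have hsum : shapeConst q n * ∑ P ∈ (SPP.bounded_finite n c).toFinset, q ^ sppNorm P =
      alternantSum (c + n) (fun i : Fin n => q ^ ((i : ℕ) + 1)) := by
    rw [sum_bounded_eq, Finset.mul_sum]
    exact Finset.sum_congr rfl fun l hl => shapeConst_mul_sum q (mem_strictSeqs.1 hl).2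
  have hD : ∏ j ∈ Finset.range n, ∏ i ∈ Finset.range (j + 1), (1 - q ^ (j + 1 + i)) ≠ 0 := by
    refine Finset.prod_ne_zero_iff.2 fun j _ => Finset.prod_ne_zero_iff.2 fun i _ => ?_
    rw [show j + 1 + i = j + i + 1 by omega]
    exact sub_ne_zero.2 (q_pow_ne_one _).symm
  have hR : ∏ i ∈ Finset.Icc 1 n, qfac (c + i) i / qfac i i =
      ∏ j ∈ Finset.range n, ((∏ i ∈ Finset.range (j + 1), (1 - q ^ (c + (j + 1) + i))) /
        ∏ i ∈ Finset.range (j + 1), (1 - q ^ (j + 1 + i))) := by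
    rw [← Finset.Ico_add_one_right_eq_Icc, Finset.prod_Ico_eq_prod_range, Nat.add_sub_cancel]
    refine Finset.prod_congr rfl fun j _ => ?_
    rw [add_comm 1 j]
    exact qfac_div_qfac c j
  rw [hR, Finset.prod_div_distrib, eq_div_iff hD]
  refine mul_left_cancel₀ hK ?_
  rw [← mul_assoc]
  exact (congrArg (· * _) hsum).trans (alternantSum_pow q q_ne_zero q_pow_ne_one c n)
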